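/- Let z_1,…,z_n ∈ ℝ^p and c₁ ≥ 1 satisfy p/c₁ ≤ ‖z_k‖² ≤ c₁ p for all k, and |z_i · z_j| ≤ c₁ B for all i ≠ j, where B > 0 is a constant with p > 8 c₁² n B. Let θ^{(0)} = 0 and θ^{(t+1)} = θ^{(t)} + β Σ_{k=1}^n z_k / (1 + exp(θ^{(t)} · z_k)) be the gradient descent iterates on the loss R(θ) = Σ_k log(1 + exp(−θ·z_k)), with learning rate β ≤ (1/2)(c₁ p + 2 n c₁ B)^{-1}. Then for every iteration t ≥ 0 and all i, j ∈ [n]: exp(−θ^{(t)} · z_i) / exp(−θ^{(t)} · z_j) ≤ 4 c₁². -/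

import Mathlib

open MeasureTheory Real
open scoped ENNReal

noncomputable section

/-- The set of admissible constants in the definition of the exponential
Orlicz (quasi-)norm of order `a` of a real random variable `X` under `μ`. -/
def orliczSet {Ω : Type*} [MeasurableSpace Ω] (μ : Measure Ω) (a : ℝ) (X : Ω → ℝ) : Set ℝ :=
  {t : ℝ | 0 < t ∧ ∫⁻ ω, ENNReal.ofReal (Real.exp (|X ω| ^ a / t ^ a)) ∂μ ≤ 2}

/-- The exponential Orlicz norm `‖X‖_{ψ_a}`. -/
def orliczNorm {Ω : Type*} [MeasurableSpace Ω] (μ : Measure Ω) (a : ℝ) (X : Ω → ℝ) : ℝ :=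
  sInf (orliczSet μ a X)

/-- Euclidean dot product on `Fin p → ℝ`. -/
def dotp {p : ℕ} (u v : Fin p → ℝ) : ℝ := ∑ i, u i * v i

/-- Squared Euclidean norm on `Fin p → ℝ`. -/
def sqnorm {p : ℕ} (u : Fin p → ℝ) : ℝ := ∑ i, u i ^ 2

/-- Euclidean norm on `Fin p → ℝ`. -/
def euclNorm {p : ℕ} (u : Fin p → ℝ) : ℝ := Real.sqrt (sqnorm u)

/-- Total variation distance between two measures. -/
def tvDist {Ω : Type*} [MeasurableSpace Ω] (P Q : Measure Ω) : ℝ :=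
  ⨆ s : {s : Set Ω // MeasurableSet s}, |(P s.1).toReal - (Q s.1).toReal|

/-- The uniform distribution on `{-1, 1} ⊆ ℝ`. -/
def signMeasure : Measure ℝ :=
  (2 : ℝ≥0∞)⁻¹ • Measure.dirac (-1) + (2 : ℝ≥0∞)⁻¹ • Measure.dirac 1

instance : IsProbabilityMeasure signMeasure := by
  constructor
  simp [signMeasure, Measure.add_apply, Measure.smul_apply, smul_eq_mul]
  exact ENNReal.inv_two_add_inv_two

/-- The label-flip distribution: takes the value `-1` with probability `η`
and the value `1` with probability `1 - η`. -/
def flipM (η : ℝ) : Measure ℝ :=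
  ENNReal.ofReal η • Measure.dirac (-1) + ENNReal.ofReal (1 - η) • Measure.dirac 1

instance (η : ℝ) : IsFiniteMeasure (flipM η) := by
  constructor
  simp only [flipM, Measure.add_apply, Measure.smul_apply, smul_eq_mul, measure_univ, mul_one]
  exact ENNReal.add_lt_top.mpr ⟨ENNReal.ofReal_lt_top, ENNReal.ofReal_lt_top⟩

/-- The "clean" distribution `P̃`: the law of `(U q + ỹ μ, ỹ)` where `q ∼ P_clust` and
`ỹ` is a uniform random sign, independent of `q`. -/
def cleanDist {p : ℕ} (Pc : Fin p → Measure ℝ) [∀ j, SigmaFinite (Pc j)]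
    (U : Matrix (Fin p) (Fin p) ℝ) (μv : Fin p → ℝ) : Measure ((Fin p → ℝ) × ℝ) :=
  ((Measure.pi Pc).prod signMeasure).map fun qy => (U.mulVec qy.1 + qy.2 • μv, qy.2)

/-- Largest singular value of a matrix, i.e. its Euclidean operator norm. -/
def s1 {p n : ℕ} (X : Matrix (Fin p) (Fin n) ℝ) : ℝ :=
  sSup {r : ℝ | ∃ u : Fin n → ℝ, sqnorm u ≤ 1 ∧ r = euclNorm (X.mulVec u)}

/-- Linear separability of a labelled sample. -/
def LinSep {p n : ℕ} (x : Fin n → Fin p → ℝ) (y : Fin n → ℝ) : Prop :=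
  ∃ v : Fin p → ℝ, ∀ i, 0 < y i * dotp v (x i)

/-- `w` is the maximum margin (minimum norm) classifier for the sample `(x, y)`. -/
def IsMaxMargin {p n : ℕ} (x : Fin n → Fin p → ℝ) (y : Fin n → ℝ) (w : Fin p → ℝ) : Prop :=
  (∀ i, 1 ≤ y i * dotp w (x i)) ∧
    ∀ u : Fin p → ℝ, (∀ i, 1 ≤ y i * dotp u (x i)) → euclNorm w ≤ euclNorm u

/-- The generalized normal distribution with location `0`, scale `σ` and shape `γ`. -/
def genNormal (σ γ : ℝ) : Measure ℝ :=
  volume.withDensity fun x =>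
    ENNReal.ofReal (γ / (2 * σ * Real.Gamma (1 / γ)) * Real.exp (-|x / σ| ^ γ))

/-- The sample-generating measure in the reduced model (`U = I`): independent coordinates
`q_k ∼ P_clust` (i.i.d.), `ỹ_k` uniform signs (i.i.d.), and label-flip signs `ε_k` (i.i.d.,
`ε_k = -1` with probability `η`). -/
def sampleMeasure (p n : ℕ) (Pc : Fin p → Measure ℝ) [∀ j, SigmaFinite (Pc j)] (η : ℝ) :
    Measure ((Fin n → Fin p → ℝ) × ((Fin n → ℝ) × (Fin n → ℝ))) :=
  (Measure.pi fun _ : Fin n => Measure.pi Pc).prod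
    ((Measure.pi fun _ : Fin n => signMeasure).prod (Measure.pi fun _ : Fin n => flipM η))

/-- The input vector `x = q + ỹ μ` in the reduced model. -/
def xvec {p : ℕ} (μv : Fin p → ℝ) (q : Fin p → ℝ) (ty : ℝ) : Fin p → ℝ :=
  fun i => q i + ty * μv i

/-- The vector `z = y x = (ε ỹ) (q + ỹ μ)` in the reduced model. -/
def zvec {p : ℕ} (μv : Fin p → ℝ) (q : Fin p → ℝ) (ty e : ℝ) : Fin p → ℝ :=
  fun i => e * ty * (q i + ty * μv i)

end

lemma dotp_add_left {p : ℕ} (u v w : Fin p → ℝ) : dotp (u + v) w = dotp u w + dotp v w := by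
  simp [dotp, add_mul, Finset.sum_add_distrib]

lemma dotp_smul_left {p : ℕ} (a : ℝ) (u w : Fin p → ℝ) : dotp (a • u) w = a * dotp u w := by
  simp [dotp, Finset.mul_sum, mul_assoc]

lemma dotp_sum_left {p : ℕ} {ι : Type*} (s : Finset ι) (f : ι → Fin p → ℝ) (w : Fin p → ℝ) :
    dotp (∑ k ∈ s, f k) w = ∑ k ∈ s, dotp (f k) w := by
  simp only [dotp, Finset.sum_apply, Finset.sum_mul]
  exact Finset.sum_comm

lemma dotp_self {p : ℕ} (u : Fin p → ℝ) : dotp u u = sqnorm u := by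
  simp [dotp, sqnorm, sq]

/-- For nearly orthogonal vectors, pairing a nonnegative combination with one of them
isolates its own coefficient up to a small error. -/
lemma abs_dotp_sum_smul_sub_le {p n : ℕ} (z : Fin n → Fin p → ℝ) (w : Fin n → ℝ) {C : ℝ}
    (hC : 0 ≤ C) (hw : ∀ k, 0 ≤ w k) (hz : ∀ i j, i ≠ j → |dotp (z i) (z j)| ≤ C) (i : Fin n) :
    |dotp (∑ k, w k • z k) (z i) - w i * sqnorm (z i)| ≤ C * ∑ k, w k := by
  have hsum : dotp (∑ k, w k • z k) (z i) - w i * sqnorm (z i)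
      = ∑ k ∈ Finset.univ.erase i, w k * dotp (z k) (z i) := by
    rw [dotp_sum_left, ← Finset.add_sum_erase _ _ (Finset.mem_univ i)]
    simp only [dotp_smul_left, dotp_self]
    ring
  rw [hsum, Finset.mul_sum]
  calc |∑ k ∈ Finset.univ.erase i, w k * dotp (z k) (z i)|
      ≤ ∑ k ∈ Finset.univ.erase i, |w k * dotp (z k) (z i)| := Finset.abs_sum_le_sum_abs _ _
    _ ≤ ∑ k ∈ Finset.univ.erase i, C * w k := by
        refine Finset.sum_le_sum fun k hk => ?_
        rw [abs_mul, abs_of_nonneg (hw k), mul_comm]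
        exact mul_le_mul_of_nonneg_right (hz k i (Finset.ne_of_mem_erase hk)) (hw k)
    _ ≤ ∑ k, C * w k :=
        Finset.sum_le_sum_of_subset_of_nonneg (Finset.erase_subset _ _)
          fun k _ _ => mul_nonneg hC (hw k)

lemma inv_one_add_exp_eq (x : ℝ) :
    (1 + Real.exp x)⁻¹ = Real.exp (-x) / (1 + Real.exp (-x)) := by
  rw [Real.exp_neg]
  have := Real.exp_pos x
  field_simp
  ring

/-- Comparison of logistic weights `a / (1 + a)` of three exponential losses in `(0, 1]`. -/
lemma logistic_weight_comparison {a b x d : ℝ} (ha : 0 < a) (ha1 : a ≤ 1) (hb : 0 < b)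
    (hx : 0 < x) (hx1 : x ≤ 1) (hd : 0 ≤ d) (hba : 8 / 3 * d * b ≤ a) (hxb : x ≤ 4 * d * b) :
    x / (1 + x) ≤ 4 * (a / (1 + a) - d * (b / (1 + b))) := by
  have h1 : d * (b / (1 + b)) ≤ 3 / 8 * a := by
    have : b / (1 + b) ≤ b := div_le_self hb.le (by linarith)
    nlinarith
  have h2 : x / (1 + x) ≤ 4 * (a / (1 + a) - 3 / 8 * a) := by
    have hxa : x ≤ 3 / 2 * a := by linarith
    have : 4 * (a / (1 + a) - 3 / 8 * a) = a * (5 - 3 * a) / (2 * (1 + a)) := by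
      field_simp
      ring
    rw [this, div_le_div_iff₀ (by linarith) (by linarith)]
    have hq : 0 ≤ 2 - 3 * a + 3 * a ^ 2 := by nlinarith [sq_nonneg (a - 1 / 2)]
    suffices x * (2 - 3 * a + 3 * a ^ 2) ≤ a * (5 - 3 * a) by linarith
    rcases le_total a (1 / 2) with h | h
    · have := mul_le_mul_of_nonneg_right hxa hq
      nlinarith [mul_nonneg ha.le (sub_nonneg.2 h),
        mul_nonneg (mul_nonneg ha.le ha.le) (sub_nonneg.2 h)]
    · have := mul_le_mul_of_nonneg_right hx1 hq
      nlinarith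
  linarith

/-- One gradient step preserves nonnegativity of the margins `m` and the bound on the ratios of
exponential losses; `N` are the squared norms of the samples and `S` the margin increments. -/
lemma margin_step {n : ℕ} {c B β p : ℝ} {m N S : Fin n → ℝ} (hc : 1 ≤ c) (hB : 0 < B)
    (hN : ∀ k, p / c ≤ N k ∧ N k ≤ c * p) (hp : 8 * c ^ 2 * n * B < p) (hβ : 0 < β)
    (hβ' : β * (c * p + 2 * n * c * B) ≤ 1 / 2)
    (hS : ∀ i, |S i - (1 + Real.exp (m i))⁻¹ * N i| ≤ c * B * ∑ k, (1 + Real.exp (m k))⁻¹)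
    (hm : ∀ k, 0 ≤ m k) (hr : ∀ i j, Real.exp (m j - m i) ≤ 4 * c ^ 2) :
    (∀ k, 0 ≤ m k + β * S k) ∧
      ∀ i j, Real.exp ((m j + β * S j) - (m i + β * S i)) ≤ 4 * c ^ 2 := by
  set g : Fin n → ℝ := fun k => (1 + Real.exp (m k))⁻¹ with hg
  change ∀ i, |S i - g i * N i| ≤ c * B * ∑ k, g k at hS
  have hc0 : 0 < c := by linarith
  have hn : (0 : ℝ) ≤ n := Nat.cast_nonneg n
  have hp0 : 0 < p := lt_of_le_of_lt (by positivity) hp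
  obtain ⟨q, hq⟩ : ∃ q, q = p / c := ⟨_, rfl⟩
  have hpq : p = c * q := by rw [hq]; field_simp
  have hq0 : 0 < q := by rw [hq]; positivity
  have hnq : 8 * (c * B * n) ≤ q := by
    rw [hpq] at hp
    nlinarith
  rw [← hq] at hN
  have hg0 : ∀ k, 0 < g k := fun k => by simp only [hg]; positivity
  have hg2 : ∀ k, g k ≤ 1 / 2 := fun k => by
    simp only [hg, one_div]
    exact inv_anti₀ two_pos (by linarith [Real.one_le_exp (hm k)])
  have hG : ∀ M, (∀ k, g k ≤ M) → c * B * ∑ k, g k ≤ c * B * n * M := fun M hM => by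
    have : ∑ k, g k ≤ n * M := by
      simpa using Finset.sum_le_card_nsmul Finset.univ g M fun k _ => hM k
    nlinarith [mul_pos hc0 hB]
  have hlow : ∀ k, g k * q - c * B * ∑ k, g k ≤ S k := fun k => by
    nlinarith [abs_le.1 (hS k), hg0 k, hN k]
  have hupp : ∀ k, S k ≤ g k * (c * p) + c * B * ∑ k, g k := fun k => by
    nlinarith [abs_le.1 (hS k), hg0 k, hN k]
  have hhalf := hG _ hg2
  refine ⟨fun k => ?_, fun i j => ?_⟩
  · rcases le_or_gt (1 / 8) (g k) with h | h
    · have : 0 ≤ S k := by nlinarith [hlow k]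
      nlinarith [hm k]
    · have hmk : 1 ≤ m k := by
        by_contra! hlt
        have h1 : Real.exp (m k) ≤ 3 :=
          (Real.exp_le_exp.2 hlt.le).trans (by linarith [Real.exp_one_lt_d9])
        have h2 : (4 : ℝ)⁻¹ ≤ g k := inv_anti₀ (by positivity) (by linarith)
        norm_num at h2
        linarith
      have h3 : -(c * B * n) ≤ S k := by
        nlinarith [hlow k, mul_pos (hg0 k) hq0, mul_nonneg (mul_pos hc0 hB).le hn]
      nlinarith [mul_le_mul_of_nonneg_left h3 hβ.le, mul_pos hβ (mul_pos hc0 hp0)]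
  · have key : (m j + β * S j) - (m i + β * S i) = (m j - m i) + β * (S j - S i) := by ring
    rw [key]
    rcases le_total (8 / 3 * c ^ 2) (Real.exp (m j - m i)) with h | h
    · refine le_trans (Real.exp_le_exp.2 ?_) (hr i j)
      have hM : ∀ k, g k ≤ 4 * (g i - c ^ 2 * g j) := fun k => by
        simp only [hg, inv_one_add_exp_eq]
        have hsub : ∀ u v : Fin n,
            Real.exp (-m u) = Real.exp (m v - m u) * Real.exp (-m v) := fun u v => by
          rw [← Real.exp_add]
          congr 1
          ring
        refine logistic_weight_comparison (Real.exp_pos _)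
          (Real.exp_le_one_iff.2 (by linarith [hm i]))
          (Real.exp_pos _) (Real.exp_pos _) (Real.exp_le_one_iff.2 (by linarith [hm k]))
          (sq_nonneg c) ?_ ?_
        · rw [hsub i j]
          exact mul_le_mul_of_nonneg_right h (Real.exp_pos _).le
        · rw [hsub k j]
          exact mul_le_mul_of_nonneg_right (hr k j) (Real.exp_pos _).le
      have hM0 : 0 ≤ 4 * (g i - c ^ 2 * g j) := (hg0 i).le.trans (hM i)
      have h1 := hG _ hM
      have h2 := mul_le_mul_of_nonneg_right hnq hM0
      have h3 : g j * (c * p) = q * (c ^ 2 * g j) := by rw [hpq]; ring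
      have : S j - S i ≤ 0 := by linarith [hlow i, hupp j]
      nlinarith
    · have h1 : S j - S i ≤ 1 / 2 * (c * p + 2 * n * c * B) := by
        nlinarith [hlow i, hupp j, mul_pos (hg0 i) hq0,
          mul_le_mul_of_nonneg_right (hg2 j) (mul_pos hc0 hp0).le]
      have h2 : β * (S j - S i) ≤ 1 / 4 := by nlinarith
      have h3 : Real.exp (β * (S j - S i)) ≤ 3 / 2 := by
        refine (Real.exp_le_exp.2 h2).trans ?_
        have h4 := Real.add_one_le_exp (-(1 / 4) : ℝ)
        have h5 : Real.exp (1 / 4) * Real.exp (-(1 / 4)) = 1 := by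
          rw [← Real.exp_add]
          simp
        nlinarith [Real.exp_pos (1 / 4)]
      rw [Real.exp_add]
      calc Real.exp (m j - m i) * Real.exp (β * (S j - S i))
          ≤ (8 / 3 * c ^ 2) * (3 / 2) := by gcongr
        _ = 4 * c ^ 2 := by ring

/-- along gradient descent on the logistic loss with a small enough
learning rate, the ratio of exponential losses between any two samples stays `≤ 4 c₁²`. -/
theorem exp_loss_ratio_bounded
    (p n : ℕ) (z : Fin n → Fin p → ℝ) (c₁ B β : ℝ)
    (hc₁ : 1 ≤ c₁) (hB : 0 < B)
    (h1 : ∀ k, (p : ℝ) / c₁ ≤ sqnorm (z k) ∧ sqnorm (z k) ≤ c₁ * p)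
    (h2 : ∀ i j, i ≠ j → |dotp (z i) (z j)| ≤ c₁ * B)
    (hp : 8 * c₁ ^ 2 * n * B < (p : ℝ))
    (hβpos : 0 < β)
    (hβ : β ≤ 1 / 2 * (c₁ * p + 2 * n * c₁ * B)⁻¹)
    (θ : ℕ → Fin p → ℝ) (hθ0 : θ 0 = 0)
    (hθ : ∀ t, θ (t + 1) = θ t + β • ∑ k, (1 + Real.exp (dotp (θ t) (z k)))⁻¹ • z k) :
    ∀ t, ∀ i j, Real.exp (-dotp (θ t) (z i)) / Real.exp (-dotp (θ t) (z j)) ≤ 4 * c₁ ^ 2 := by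
  have hc0 : 0 < c₁ := by linarith
  have hp0 : (0 : ℝ) < p := lt_of_le_of_lt (by positivity) hp
  have hβ' : β * (c₁ * p + 2 * n * c₁ * B) ≤ 1 / 2 := by
    have hpos : 0 < c₁ * p + 2 * n * c₁ * B := by positivity
    rwa [← div_eq_mul_inv, le_div_iff₀ hpos] at hβ
  have main : ∀ t, (∀ k, 0 ≤ dotp (θ t) (z k)) ∧
      ∀ i j, Real.exp (dotp (θ t) (z j) - dotp (θ t) (z i)) ≤ 4 * c₁ ^ 2 := by
    intro t
    induction t with
    | zero =>
      simp only [hθ0, dotp, Pi.zero_apply, zero_mul, Finset.sum_const_zero, le_refl, sub_self,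
        Real.exp_zero, implies_true, true_and]
      intro _ _
      nlinarith
    | succ t ih =>
      simp only [hθ t, dotp_add_left, dotp_smul_left]
      exact margin_step hc₁ hB h1 hp hβpos hβ'
        (abs_dotp_sum_smul_sub_le z _ (by positivity) (fun k => by positivity) h2) ih.1 ih.2
  intro t i j
  rw [← Real.exp_sub, neg_sub_neg]
  exact (main t).2 i j
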